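/- arXiv:1401.6040 — 8 statements merged into one kernel-verified Lean document; each statement's English description precedes it below -/
import Mathlib

section
/- Let d₁ ≤ d₂ be positive integers, let A be a d₁-AP-set and let B be a d₂-AP-set. Then A+B is a d-AP-set for some positive integer d if and only if there is a positive integer k with d₂ = k·d₁ and k ≤ |A|; moreover, in that case A+B is a d₁-AP-set. -/
open Pointwise

/-- A finite set of naturals is a `d`-AP-set if `d > 0`, it has at least 3 elements,
and its elements form an arithmetic progression with common difference `d`. -/
def IsAPSet (d : ℕ) (A : Finset ℕ) : Prop :=
  0 < d ∧ 3 ≤ A.card ∧ ∃ a : ℕ, A = (Finset.range A.card).image (fun i => a + i * d)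

theorem card_eq_of_mem_iff_progression {d a n : ℕ} {S : Finset ℕ} (hd : 0 < d)
    (hS : ∀ x, x ∈ S ↔ ∃ i < n, x = a + i * d) : S.card = n := by
  have himage : S = (Finset.range n).image (fun i => a + i * d) := by
    ext x
    simp [hS, eq_comm]
  rw [himage, Finset.card_image_of_injective, Finset.card_range]
  intro i j hij
  exact Nat.eq_of_mul_eq_mul_right hd (Nat.add_left_cancel hij)

theorem isAPSet_iff {d : ℕ} {S : Finset ℕ} :
    IsAPSet d S ↔ 0 < d ∧ ∃ a n, 3 ≤ n ∧ ∀ x, x ∈ S ↔ ∃ i < n, x = a + i * d := by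
  constructor
  · rintro ⟨hd, hS, a, ha⟩
    refine ⟨hd, a, S.card, hS, fun x => ?_⟩
    conv_lhs => rw [ha]
    simp [eq_comm]
  · rintro ⟨hd, a, n, hn, hS⟩
    have hcard := card_eq_of_mem_iff_progression hd hS
    refine ⟨hd, hcard ▸ hn, a, ?_⟩
    ext x
    simp [hS, hcard, eq_comm]

theorem exists_add_mul_eq_of_lt {k n m t : ℕ} (hk : 0 < k) (hkn : k ≤ n) (hm : 0 < m)
    (ht : t < n + (m - 1) * k) : ∃ i < n, ∃ j < m, i + j * k = t := by
  by_cases h : t / k < m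
  · exact ⟨t % k, (Nat.mod_lt t hk).trans_le hkn, t / k, h, Nat.mod_add_div' t k⟩
  · have hle : (m - 1) * k ≤ t :=
      (Nat.mul_le_mul_right k (by omega)).trans (Nat.div_mul_le_self t k)
    exact ⟨t - (m - 1) * k, by omega, m - 1, by omega, by omega⟩

theorem IsAPSet.add_of_eq_mul {d k : ℕ} {A B : Finset ℕ} (hA : IsAPSet d A)
    (hB : IsAPSet (k * d) B) (hk : 0 < k) (hkA : k ≤ A.card) : IsAPSet d (A + B) := by
  obtain ⟨hd, a, n, hn, hA⟩ := isAPSet_iff.1 hA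
  obtain ⟨-, b, m, hm, hB⟩ := isAPSet_iff.1 hB
  rw [card_eq_of_mem_iff_progression hd hA] at hkA
  refine isAPSet_iff.2 ⟨hd, a + b, n + (m - 1) * k, by omega, fun x => ?_⟩
  rw [Finset.mem_add]
  constructor
  · rintro ⟨y, hy, z, hz, rfl⟩
    obtain ⟨i, hi, rfl⟩ := (hA y).1 hy
    obtain ⟨j, hj, rfl⟩ := (hB z).1 hz
    have hjk : j * k ≤ (m - 1) * k := Nat.mul_le_mul_right k (by omega)
    exact ⟨i + j * k, by omega, by ring⟩
  · rintro ⟨t, ht, rfl⟩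
    obtain ⟨i, hi, j, hj, rfl⟩ := exists_add_mul_eq_of_lt hk hkA (by omega) ht
    exact ⟨_, (hA _).2 ⟨i, hi, rfl⟩, _, (hB _).2 ⟨j, hj, rfl⟩, by ring⟩

theorem IsAPSet.exists_eq_mul_of_add {d d₁ d₂ : ℕ} {A B : Finset ℕ} (hle : d₁ ≤ d₂)
    (hA : IsAPSet d₁ A) (hB : IsAPSet d₂ B) (hAB : IsAPSet d (A + B)) :
    ∃ k : ℕ, 0 < k ∧ d₂ = k * d₁ ∧ k ≤ A.card := by
  obtain ⟨hd₁, a, n, hn, hA⟩ := isAPSet_iff.1 hA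
  obtain ⟨hd₂, b, m, hm, hB⟩ := isAPSet_iff.1 hB
  obtain ⟨hd, c, N, hN, hAB⟩ := isAPSet_iff.1 hAB
  rw [card_eq_of_mem_iff_progression hd₁ hA]
  have of_lt : ∀ i < n, ∀ j < m, ∃ t < N, a + b + (i * d₁ + j * d₂) = c + t * d := by
    intro i hi j hj
    obtain ⟨t, ht, h⟩ := (hAB _).1
      (Finset.add_mem_add ((hA _).2 ⟨i, hi, rfl⟩) ((hB _).2 ⟨j, hj, rfl⟩))
    exact ⟨t, ht, by omega⟩
  have to_lt : ∀ t < N, ∃ i < n, ∃ j < m, c + t * d = a + b + (i * d₁ + j * d₂) := by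
    intro t ht
    obtain ⟨y, hy, z, hz, h⟩ := Finset.mem_add.1 ((hAB _).2 ⟨t, ht, rfl⟩)
    obtain ⟨i, hi, rfl⟩ := (hA y).1 hy
    obtain ⟨j, hj, rfl⟩ := (hB z).1 hz
    exact ⟨i, hi, j, hj, by omega⟩
  obtain rfl : c = a + b := by
    obtain ⟨_, -, h⟩ := of_lt 0 (by omega) 0 (by omega)
    obtain ⟨_, -, _, -, h'⟩ := to_lt 0 (by omega)
    omega
  obtain rfl : d = d₁ := by
    apply le_antisymm
    · obtain ⟨t, -, h⟩ := of_lt 1 (by omega) 0 (by omega)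
      exact Nat.le_of_dvd hd₁ ⟨t, by linarith⟩
    · obtain ⟨i, -, j, -, h⟩ := to_lt 1 (by omega)
      rcases Nat.eq_zero_or_pos i with rfl | hi
      · rcases Nat.eq_zero_or_pos j with rfl | hj
        · omega
        · nlinarith
      · nlinarith
  obtain ⟨k, hkN, hk⟩ := of_lt 0 (by omega) 1 (by omega)
  obtain rfl : d₂ = k * d := by omega
  refine ⟨k, Nat.pos_of_mul_pos_right hd₂, rfl, ?_⟩
  by_contra! hnk
  obtain ⟨i, hi, j, -, h⟩ := to_lt n (by omega)
  have hij : n = i + j * k := Nat.eq_of_mul_eq_mul_right hd (by linarith)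
  rcases Nat.eq_zero_or_pos j with rfl | hj
  · omega
  · nlinarith

/-- For a `d₁`-AP-set `A` and a `d₂`-AP-set `B` with `d₁ ≤ d₂`, the sumset `A + B` is a
`d`-AP-set for some positive `d` iff `d₂ = k · d₁` for some positive integer `k ≤ |A|`;
in that case `A + B` is a `d₁`-AP-set. -/
theorem stmt1 (d₁ d₂ : ℕ) (hle : d₁ ≤ d₂) (A B : Finset ℕ)
    (hA : IsAPSet d₁ A) (hB : IsAPSet d₂ B) :
    ((∃ d, IsAPSet d (A + B)) ↔ ∃ k : ℕ, 0 < k ∧ d₂ = k * d₁ ∧ k ≤ A.card) ∧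
    ((∃ k : ℕ, 0 < k ∧ d₂ = k * d₁ ∧ k ≤ A.card) → IsAPSet d₁ (A + B)) := by
  have hadd : (∃ k : ℕ, 0 < k ∧ d₂ = k * d₁ ∧ k ≤ A.card) → IsAPSet d₁ (A + B) := by
    rintro ⟨k, hk, rfl, hkA⟩
    exact hA.add_of_eq_mul hB hk hkA
  exact ⟨⟨fun ⟨_, hAB⟩ => hA.exists_eq_mul_of_add hle hB hAB, fun h => ⟨d₁, hadd h⟩⟩, hadd⟩
end

section
/- Let G be a finite simple graph and let f be an injective labeling of its vertices by AP-sets, where f(v) is a d_v-AP-set with deterministic index d_v. Then every edge label f⁺(uv) = f(u)+f(v) is an AP-set if and only if for every edge uv of G, writing the two endpoints so that d_u ≤ d_v, there is a positive integer k ≤ |f(u)| with d_v = k·d_u. -/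
open Pointwise

/-- The arithmetic progression `a, a + d, …` with `n` terms. -/
def apFinset (a d n : ℕ) : Finset ℕ := (Finset.range n).image (fun i => a + i * d)

lemma mem_apFinset {a d n x : ℕ} : x ∈ apFinset a d n ↔ ∃ i < n, a + i * d = x := by
  simp [apFinset]

lemma card_apFinset {a d n : ℕ} (hd : 0 < d) : (apFinset a d n).card = n := by
  rw [apFinset, Finset.card_image_of_injective, Finset.card_range]
  intro i j h
  exact Nat.eq_of_mul_eq_mul_right hd (Nat.add_left_cancel h)

lemma isAPSet_apFinset {a d n : ℕ} (hd : 0 < d) (hn : 3 ≤ n) : IsAPSet d (apFinset a d n) := by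
  refine ⟨hd, ?_, a, ?_⟩ <;> rw [card_apFinset hd]
  · exact hn
  · rfl

lemma mem_apFinset_add {a b p q m n x : ℕ} :
    x ∈ apFinset a p m + apFinset b q n ↔
      ∃ i < m, ∃ j < n, a + b + (i * p + j * q) = x := by
  simp only [Finset.mem_add, mem_apFinset]
  constructor
  · rintro ⟨_, ⟨i, hi, rfl⟩, _, ⟨j, hj, rfl⟩, rfl⟩
    exact ⟨i, hi, j, hj, by ring⟩
  · rintro ⟨i, hi, j, hj, rfl⟩
    exact ⟨_, ⟨i, hi, rfl⟩, _, ⟨j, hj, rfl⟩, by ring⟩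

lemma apFinset_add_apFinset_mul {a b p m n k : ℕ} (hk : 0 < k) (hkm : k ≤ m) :
    apFinset a p m + apFinset b (k * p) (n + 1) = apFinset (a + b) p (m + n * k) := by
  ext x
  rw [mem_apFinset_add, mem_apFinset]
  constructor
  · rintro ⟨i, hi, j, hj, rfl⟩
    have : j * k ≤ n * k := Nat.mul_le_mul_right k (by omega)
    exact ⟨i + j * k, by omega, by ring⟩
  · rintro ⟨l, hl, rfl⟩
    obtain ⟨i, hi, j, hj, rfl⟩ : ∃ i < m, ∃ j < n + 1, i + j * k = l := by
      by_cases h : l < n * k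
      · have hj : l / k < n := (Nat.div_lt_iff_lt_mul hk).2 h
        exact ⟨l % k, (Nat.mod_lt l hk).trans_le hkm, l / k, by omega, Nat.mod_add_div' l k⟩
      · exact ⟨l - n * k, by omega, n, by omega, by omega⟩
    exact ⟨i, hi, j, hj, by ring⟩

lemma exists_eq_mul_of_apFinset_add_eq {a b c p q δ m n N : ℕ} (hp : 0 < p) (hpq : p ≤ q)
    (hm : 2 ≤ m) (hn : 2 ≤ n) (hδ : 0 < δ) (hN : 2 ≤ N)
    (h : apFinset a p m + apFinset b q n = apFinset c δ N) :
    ∃ k : ℕ, 0 < k ∧ k ≤ m ∧ q = k * p := by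
  have of_mem (i j : ℕ) (hi : i < m) (hj : j < n) :
      ∃ l < N, c + l * δ = a + b + (i * p + j * q) :=
    mem_apFinset.1 (h ▸ mem_apFinset_add.2 ⟨i, hi, j, hj, rfl⟩)
  have mem_of (l : ℕ) (hl : l < N) :
      ∃ i < m, ∃ j < n, a + b + (i * p + j * q) = c + l * δ :=
    mem_apFinset_add.1 (h ▸ mem_apFinset.2 ⟨l, hl, rfl⟩)
  have hc : c = a + b := by
    obtain ⟨l, -, h₁⟩ := of_mem 0 0 (by omega) (by omega)
    obtain ⟨i, -, j, -, h₂⟩ := mem_of 0 (by omega)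
    simp only [zero_mul] at h₁ h₂
    omega
  subst hc
  have hpδ : δ = p := by
    apply le_antisymm
    · obtain ⟨l, -, hl⟩ := of_mem 1 0 (by omega) (by omega)
      rcases Nat.eq_zero_or_pos l with rfl | h₁
      · omega
      · have := Nat.le_mul_of_pos_left δ h₁
        omega
    · obtain ⟨i, -, j, -, hij⟩ := mem_of 1 (by omega)
      rcases Nat.eq_zero_or_pos i with rfl | h₁
      · rcases Nat.eq_zero_or_pos j with rfl | h₂
        · omega
        · have := Nat.le_mul_of_pos_left q h₂
          omega
      · have := Nat.le_mul_of_pos_left p h₁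
        omega
  subst hpδ
  obtain ⟨k, hkN, hk⟩ := of_mem 0 1 (by omega) (by omega)
  obtain rfl : q = k * δ := by omega
  have hk0 : 0 < k := Nat.pos_of_mul_pos_right (hp.trans_le hpq)
  refine ⟨k, hk0, ?_, rfl⟩
  by_contra! hmk
  obtain ⟨i, hi, j, -, hij⟩ := mem_of m (by omega)
  have hm' : i + j * k = m := Nat.eq_of_mul_eq_mul_right hp (by linarith)
  rcases Nat.eq_zero_or_pos j with rfl | hj
  · omega
  · have := Nat.le_mul_of_pos_left k hj
    omega

lemma IsAPSet.exists_eq_apFinset {d : ℕ} {A : Finset ℕ} (hA : IsAPSet d A) :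
    ∃ a, A = apFinset a d A.card := hA.2.2

/-- The sum of two AP-sets with differences `p ≤ q` is an AP-set iff `q` is a positive multiple
of `p` by a factor at most the size of the first set. -/
lemma IsAPSet.exists_isAPSet_add_iff {p q : ℕ} {A B : Finset ℕ} (hA : IsAPSet p A)
    (hB : IsAPSet q B) (hpq : p ≤ q) :
    (∃ δ, IsAPSet δ (A + B)) ↔ ∃ k : ℕ, 0 < k ∧ k ≤ A.card ∧ q = k * p := by
  obtain ⟨a, ha⟩ := hA.exists_eq_apFinset
  obtain ⟨b, hb⟩ := hB.exists_eq_apFinset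
  have hm := hA.2.1
  have hn := hB.2.1
  constructor
  · rintro ⟨δ, hδ⟩
    obtain ⟨c, hc⟩ := hδ.exists_eq_apFinset
    have hN := hδ.2.1
    refine exists_eq_mul_of_apFinset_add_eq (a := a) (b := b) (c := c) (n := B.card)
      (N := (A + B).card) hA.1 hpq (by omega) (by omega) hδ.1 (by omega) ?_
    rw [← ha, ← hb, ← hc]
  · rintro ⟨k, hk, hkm, rfl⟩
    obtain ⟨n, hn'⟩ : ∃ n, B.card = n + 1 := ⟨B.card - 1, by omega⟩
    rw [hn'] at hb
    refine ⟨p, ?_⟩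
    rw [ha, hb, apFinset_add_apFinset_mul hk hkm]
    exact isAPSet_apFinset hA.1 (by omega)

/-- For an injective labeling of the vertices of a finite simple graph by AP-sets, every
edge label is an AP-set iff for every edge `uv` with `d_u ≤ d_v` there is a positive
integer `k ≤ |f(u)|` with `d_v = k · d_u`. -/
theorem stmt2 {V : Type*} [Fintype V] (G : SimpleGraph V) (f : V → Finset ℕ)
    (hf : Function.Injective f) (d : V → ℕ) (hAP : ∀ v, IsAPSet (d v) (f v)) :
    (∀ u v, G.Adj u v → ∃ δ, IsAPSet δ (f u + f v)) ↔
      (∀ u v, G.Adj u v → d u ≤ d v →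
        ∃ k : ℕ, 0 < k ∧ k ≤ (f u).card ∧ d v = k * d u) := by
  constructor
  · intro h u v huv hle
    exact ((hAP u).exists_isAPSet_add_iff (hAP v) hle).1 (h u v huv)
  · intro h u v huv
    rcases le_total (d u) (d v) with hle | hle
    · exact ((hAP u).exists_isAPSet_add_iff (hAP v) hle).2 (h u v huv hle)
    · rw [add_comm]
      exact ((hAP v).exists_isAPSet_add_iff (hAP u) hle).2 (h v u huv.symm hle)
end

section
/- Let f be an isoarithmetic IASI with common difference d of a finite simple graph G, and let e = uv be an edge of G. Let G∘e be the contraction of G along e: its vertex set is V(G)∖{v}, and x, y are adjacent in G∘e iff x ≠ y and either x, y are adjacent in G, or x = u and y is a G-neighbor of v, or y = u and x is a G-neighbor of v. Define g on V(G∘e) by g(u) = f(u)+f(v) and g(x) = f(x) for x ≠ u. Then every vertex label g(x) and every edge label g(x)+g(y) (for xy an edge of G∘e) is a d-AP-set. -/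
open Pointwise

/-- An integer additive set-indexer (IASI) of a simple graph `G`: an injective labeling of
vertices by nonempty finite sets of naturals whose induced edge labeling
`f⁺(uv) = f(u) + f(v)` (sumset) is injective on edges. -/
structure IsIASI {V : Type*} (G : SimpleGraph V) (f : V → Finset ℕ) : Prop where
  injective : Function.Injective f
  nonempty : ∀ v, (f v).Nonempty
  edgeInjective : ∀ ⦃u v x y : V⦄, G.Adj u v → G.Adj x y →
    f u + f v = f x + f y → s(u, v) = s(x, y)

/-- An isoarithmetic IASI of `G` with common difference `d`: an IASI all of whose vertex
and edge labels are `d`-AP-sets. -/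
def IsIsoarithmeticIASI {V : Type*} (G : SimpleGraph V) (f : V → Finset ℕ) (d : ℕ) : Prop :=
  IsIASI G f ∧ (∀ v, IsAPSet d (f v)) ∧ (∀ u v, G.Adj u v → IsAPSet d (f u + f v))

theorem isAPSet_image_range {d n : ℕ} (hd : 0 < d) (hn : 3 ≤ n) (a : ℕ) :
    IsAPSet d ((Finset.range n).image fun i => a + i * d) := by
  have hcard : ((Finset.range n).image fun i => a + i * d).card = n := by
    rw [Finset.card_image_of_injective _ fun i j hij =>
      Nat.eq_of_mul_eq_mul_right hd (Nat.add_left_cancel hij), Finset.card_range]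
  exact ⟨hd, hcard.symm ▸ hn, a, by rw [hcard]⟩

theorem image_range_add_image_range (a b d m n : ℕ) :
    ((Finset.range (m + 1)).image fun i => a + i * d) +
      ((Finset.range (n + 1)).image fun i => b + i * d) =
    (Finset.range (m + n + 1)).image fun i => a + b + i * d := by
  ext x
  simp only [Finset.mem_add, Finset.mem_image, Finset.mem_range]
  constructor
  · rintro ⟨_, ⟨i, hi, rfl⟩, _, ⟨j, hj, rfl⟩, rfl⟩
    exact ⟨i + j, by omega, by ring⟩
  · rintro ⟨k, hk, rfl⟩
    refine ⟨_, ⟨min k m, by omega, rfl⟩, _, ⟨k - min k m, by omega, rfl⟩, ?_⟩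
    obtain ⟨j, hj⟩ := Nat.exists_eq_add_of_le (Nat.min_le_left k m)
    rw [show k - min k m = j by omega]
    conv_rhs => rw [hj]
    ring

/-- The sumset of two `d`-AP-sets is a `d`-AP-set. -/
theorem IsAPSet.add {d : ℕ} {A B : Finset ℕ} (hA : IsAPSet d A) (hB : IsAPSet d B) :
    IsAPSet d (A + B) := by
  obtain ⟨hd, hA, a, ha⟩ := hA
  obtain ⟨-, hB, b, hb⟩ := hB
  obtain ⟨m, hm⟩ := Nat.exists_eq_succ_of_ne_zero (show A.card ≠ 0 by omega)
  obtain ⟨n, hn⟩ := Nat.exists_eq_succ_of_ne_zero (show B.card ≠ 0 by omega)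
  rw [ha, hb, hm, hn, image_range_add_image_range]
  exact isAPSet_image_range hd (by omega) _

/-- Contraction of an edge of an isoarithmetic IASI graph: label the merged vertex `u` by
the set-label of the deleted edge `uv`. Every vertex label and every edge label of the
contracted graph `G ∘ e` is a `d`-AP-set. -/
theorem stmt4 {V : Type*} [Fintype V] [DecidableEq V] (G : SimpleGraph V)
    (f : V → Finset ℕ) (d : ℕ) (h : IsIsoarithmeticIASI G f d)
    (u v : V) (huv : G.Adj u v)
    (g : V → Finset ℕ) (hg : ∀ x, g x = if x = u then f u + f v else f x) :
    (∀ x, x ≠ v → IsAPSet d (g x)) ∧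
    (∀ x y, x ≠ v → y ≠ v → x ≠ y →
      (G.Adj x y ∨ (x = u ∧ G.Adj v y) ∨ (y = u ∧ G.Adj v x)) →
      IsAPSet d (g x + g y)) := by
  have hgAP : ∀ x, IsAPSet d (g x) := fun x => by
    rw [hg]
    split_ifs
    · exact h.2.2 u v huv
    · exact h.2.1 x
  exact ⟨fun x _ => hgAP x, fun x y _ _ _ _ => (hgAP x).add (hgAP y)⟩
end

section
/- Let f be a biarithmetic IASI of a finite simple graph G, and suppose there is a single positive integer d such that every edge label f⁺(e) is a d-AP-set. Then G is bipartite: the set X = {v ∈ V(G) : d_v = d} and its complement form a bipartition of G (every edge has exactly one endpoint in X). -/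
open Pointwise

/-- A biarithmetic IASI of `G`: an IASI whose vertex labels are AP-sets with deterministic
indices `dv`, whose edge labels are AP-sets, and such that on each edge one deterministic
index is `k` times the other for some integer `k > 1` with `k` at most the cardinality of
the label of the vertex with the smaller index. -/
def IsBiarithmeticIASI {V : Type*} (G : SimpleGraph V) (f : V → Finset ℕ)
    (dv : V → ℕ) : Prop :=
  IsIASI G f ∧ (∀ v, IsAPSet (dv v) (f v)) ∧
    (∀ u v, G.Adj u v → ∃ δ, IsAPSet δ (f u + f v)) ∧
    (∀ u v, G.Adj u v → ∃ k : ℕ, 1 < k ∧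
      ((dv v = k * dv u ∧ k ≤ (f u).card) ∨ (dv u = k * dv v ∧ k ≤ (f v).card)))

theorem IsAPSet.modEq {d : ℕ} {A : Finset ℕ} (h : IsAPSet d A) {x y : ℕ}
    (hx : x ∈ A) (hy : y ∈ A) : x ≡ y [MOD d] := by
  obtain ⟨-, -, a, ha⟩ := h
  rw [ha, Finset.mem_image] at hx hy
  obtain ⟨i, -, rfl⟩ := hx
  obtain ⟨j, -, rfl⟩ := hy
  simp [Nat.ModEq]

theorem IsAPSet.exists_mem_add_mem {d : ℕ} {A : Finset ℕ} (h : IsAPSet d A) :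
    ∃ x ∈ A, x + d ∈ A := by
  obtain ⟨-, h3, a, ha⟩ := h
  have key : ∀ i < A.card, a + i * d ∈ A := fun i hi => by
    rw [ha]
    exact Finset.mem_image_of_mem _ (Finset.mem_range.2 hi)
  exact ⟨a, by simpa using key 0 (by lia), by simpa using key 1 (by lia)⟩

/-- If the difference of `A` divides that of `B` and `A + B` is a `d`-AP-set,
then the difference of `A` is `d`. -/
theorem IsAPSet.eq_of_add {p q d : ℕ} {A B : Finset ℕ} (hA : IsAPSet p A) (hB : IsAPSet q B)
    (hpq : p ∣ q) (h : IsAPSet d (A + B)) : p = d := by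
  apply Nat.dvd_antisymm
  · obtain ⟨x, hx, hxd⟩ := h.exists_mem_add_mem
    obtain ⟨a, ha, b, hb, hab⟩ := Finset.mem_add.1 hx
    obtain ⟨a', ha', b', hb', hab'⟩ := Finset.mem_add.1 hxd
    have hmod : x ≡ x + d [MOD p] := by
      rw [← hab', ← hab]
      exact (hA.modEq ha ha').add ((hB.modEq hb hb').of_dvd hpq)
    simpa using (Nat.modEq_iff_dvd' (Nat.le_add_right x d)).1 hmod
  · obtain ⟨a, ha, hap⟩ := hA.exists_mem_add_mem
    obtain ⟨b, hb, -⟩ := hB.exists_mem_add_mem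
    have hmod := h.modEq (Finset.add_mem_add ha hb) (Finset.add_mem_add hap hb)
    rw [add_right_comm] at hmod
    simpa using (Nat.modEq_iff_dvd' (Nat.le_add_right (a + b) p)).1 hmod

/-- If a biarithmetic IASI graph `G` has all its edge labels `d`-AP-sets for a single
positive integer `d`, then `G` is bipartite: every edge of `G` has exactly one endpoint
with deterministic index `d`. -/
theorem stmt10 {V : Type*} [Fintype V] (G : SimpleGraph V)
    (f : V → Finset ℕ) (dv : V → ℕ) (h : IsBiarithmeticIASI G f dv)
    (d : ℕ) (hd : ∀ u v, G.Adj u v → IsAPSet d (f u + f v)) :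
    ∀ u v, G.Adj u v → (dv u = d ↔ dv v ≠ d) := by
  obtain ⟨-, hAP, -, hk⟩ := h
  intro u v huv
  have hne : ∀ {m k : ℕ}, 0 < m → 1 < k → k * m ≠ m := fun hm hk1 =>
    (lt_mul_of_one_lt_left hm hk1).ne'
  obtain ⟨k, hk1, ⟨hdv, -⟩ | ⟨hdu, -⟩⟩ := hk u v huv
  · have hu := (hAP u).eq_of_add (hAP v) (hdv ▸ dvd_mul_left _ _) (hd u v huv)
    have hv : dv v ≠ d := by
      rw [hdv, ← hu]
      exact hne (hAP u).1 hk1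
    exact iff_of_true hu hv
  · have hv := (hAP v).eq_of_add (hAP u) (hdu ▸ dvd_mul_left _ _) (hd v u huv.symm)
    have hu : dv u ≠ d := by
      rw [hdu, ← hv]
      exact hne (hAP v).1 hk1
    exact iff_of_false hu (not_not.2 hv)
end

section
/- Let f be a biarithmetic IASI of a finite simple graph G, and suppose the induced labeling of the line graph L(G) by e ↦ f⁺(e) is biarithmetic in the following sense: every edge label f⁺(e) is an AP-set, and for any two distinct edges e₁, e₂ of G sharing an endpoint, the deterministic indices δ₁, δ₂ of f⁺(e₁), f⁺(e₂) satisfy δ₂ = k'·δ₁ or δ₁ = k'·δ₂ for some integer k' > 1. Then G contains no cycle (G is acyclic). -/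
open Pointwise

theorem IsAPSet.exists_mem_iff {d : ℕ} {A : Finset ℕ} (hA : IsAPSet d A) :
    ∃ a, ∀ x, x ∈ A ↔ ∃ i < A.card, a + i * d = x := by
  obtain ⟨-, -, a, ha⟩ := hA
  refine ⟨a, fun x => ?_⟩
  conv_lhs => rw [ha]
  simp

/-- The index of a sumset of two AP-sets is the smaller index when it divides the other. -/
theorem IsAPSet.index_add_eq {d e δ : ℕ} {A B : Finset ℕ} (hA : IsAPSet d A)
    (hB : IsAPSet e B) (hde : d ∣ e) (hAB : IsAPSet δ (A + B)) : δ = d := by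
  obtain ⟨a, ha⟩ := hA.exists_mem_iff
  obtain ⟨b, hb⟩ := hB.exists_mem_iff
  obtain ⟨c, hc⟩ := hAB.exists_mem_iff
  have hA3 := hA.2.1
  have hB3 := hB.2.1
  have hC3 := hAB.2.1
  have mem_add : ∀ i < A.card, ∃ n, c + n * δ = a + i * d + b := fun i hi => by
    obtain ⟨n, -, hn⟩ := (hc (a + i * d + b)).1
      (Finset.add_mem_add ((ha _).2 ⟨i, hi, rfl⟩) ((hb b).2 ⟨0, by omega, by simp⟩))
    exact ⟨n, hn⟩
  have of_mem : ∀ n < (A + B).card, ∃ m, c + n * δ = a + b + m * d := fun n hn => by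
    obtain ⟨x, hx, y, hy, hxy⟩ := Finset.mem_add.1 ((hc _).2 ⟨n, hn, rfl⟩)
    obtain ⟨i, -, rfl⟩ := (ha x).1 hx
    obtain ⟨j, -, rfl⟩ := (hb y).1 hy
    obtain ⟨k, rfl⟩ := hde
    exact ⟨i + j * k, by rw [← hxy]; ring⟩
  obtain ⟨n₀, h₀⟩ := mem_add 0 (by omega)
  obtain ⟨n₁, h₁⟩ := mem_add 1 (by omega)
  obtain ⟨m₀, g₀⟩ := of_mem 0 (by omega)
  obtain ⟨m₁, g₁⟩ := of_mem 1 (by omega)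
  have hcab : c = a + b := by
    have := Nat.zero_le (n₀ * δ)
    have := Nat.zero_le (m₀ * d)
    omega
  apply Nat.dvd_antisymm
  · exact ⟨n₁, by rw [mul_comm]; omega⟩
  · exact ⟨m₁, by rw [mul_comm]; omega⟩

theorem SimpleGraph.Walk.IsCycle.exists_two_neighbors_le {V : Type*} {G : SimpleGraph V}
    {u : V} {p : G.Walk u u} (hp : p.IsCycle) (w : V → ℕ) :
    ∃ x v y, G.Adj v x ∧ G.Adj v y ∧ x ≠ y ∧ w v ≤ w x ∧ w v ≤ w y := by
  classical
  obtain ⟨v, hv, hmin⟩ := p.support.toFinset.exists_min_image w ⟨u, by simp⟩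
  rw [List.mem_toFinset] at hv
  have hq := hp.rotate hv
  have hle : ∀ x ∈ (p.rotate v hv).support, w v ≤ w x := fun x hx =>
    hmin x (by simpa using hx)
  exact ⟨_, v, _, SimpleGraph.Walk.adj_snd hq.not_nil,
    (SimpleGraph.Walk.adj_penultimate hq.not_nil).symm, hq.snd_ne_penultimate,
    hle _ (SimpleGraph.Walk.getVert_mem_support _ _),
    hle _ (SimpleGraph.Walk.getVert_mem_support _ _)⟩

theorem IsBiarithmeticIASI.isAPSet_add {V : Type*} {G : SimpleGraph V} {f : V → Finset ℕ}
    {dv : V → ℕ} (h : IsBiarithmeticIASI G f dv) {u v : V} (huv : G.Adj u v)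
    (hle : dv u ≤ dv v) : IsAPSet (dv u) (f u + f v) := by
  obtain ⟨-, hAP, hE, hk⟩ := h
  obtain ⟨δ, hδ⟩ := hE u v huv
  obtain ⟨k, hk1, ⟨hd, -⟩ | ⟨hd, -⟩⟩ := hk u v huv
  · rwa [← (hAP u).index_add_eq (hAP v) ⟨k, by rw [hd, mul_comm]⟩ hδ]
  · have := (hAP v).1
    nlinarith

/-- If the induced labeling `e ↦ f⁺(e)` of the line graph of a biarithmetic IASI graph
`G` is biarithmetic (every edge label is an AP-set, and deterministic indices of labels
of distinct edges sharing an endpoint differ by an integer factor `k' > 1`), then `G` is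
acyclic. -/
theorem stmt11 {V : Type*} [Fintype V] (G : SimpleGraph V)
    (f : V → Finset ℕ) (dv : V → ℕ) (h : IsBiarithmeticIASI G f dv)
    (hL : ∀ a b c δ₁ δ₂, G.Adj a b → G.Adj b c → s(a, b) ≠ s(b, c) →
      IsAPSet δ₁ (f a + f b) → IsAPSet δ₂ (f b + f c) →
      ∃ k' : ℕ, 1 < k' ∧ (δ₂ = k' * δ₁ ∨ δ₁ = k' * δ₂)) :
    G.IsAcyclic := by
  intro u p hp
  obtain ⟨x, v, y, hx, hy, hxy, hvx, hvy⟩ := hp.exists_two_neighbors_le dv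
  have hpos : 0 < dv v := (h.2.1 v).1
  have hxv : IsAPSet (dv v) (f x + f v) := by
    rw [add_comm]
    exact h.isAPSet_add hx hvx
  have hne : s(x, v) ≠ s(v, y) := by
    rw [Sym2.eq_swap]
    exact fun heq => hxy (Sym2.congr_right.1 heq)
  obtain ⟨k, hk, hk' | hk'⟩ := hL x v y _ _ hx.symm hy hne hxv (h.isAPSet_add hy hvy) <;>
    nlinarith
end

section
/- For every integer k ≥ 2 and every n ≥ 2, the path graph Pₙ on n vertices admits an identical biarithmetic IASI with multiplier k. In particular, the line graph of a path with at least two edges, being itself a path, admits an identical biarithmetic IASI. -/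
open Pointwise

/-- An identical biarithmetic IASI of `G` with multiplier `k`: a biarithmetic IASI in which
the same integer `k > 1` works for every edge. -/
def IsIdenticalBiarithmeticIASI {V : Type*} (G : SimpleGraph V) (f : V → Finset ℕ)
    (dv : V → ℕ) (k : ℕ) : Prop :=
  IsIASI G f ∧ 1 < k ∧ (∀ v, IsAPSet (dv v) (f v)) ∧
    (∀ u v, G.Adj u v → ∃ δ, IsAPSet δ (f u + f v)) ∧
    (∀ u v, G.Adj u v →
      ((dv v = k * dv u ∧ k ≤ (f u).card) ∨ (dv u = k * dv v ∧ k ≤ (f v).card)))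

/-- The arithmetic progression `a, a + d, …` with `m` terms. -/
def arithProg (a d m : ℕ) : Finset ℕ :=
  (Finset.range m).image (fun i => a + i * d)

theorem mem_arithProg {a d m x : ℕ} : x ∈ arithProg a d m ↔ ∃ i < m, a + i * d = x := by
  simp [arithProg]

theorem card_arithProg (a m : ℕ) {d : ℕ} (hd : 0 < d) : (arithProg a d m).card = m := by
  rw [arithProg, Finset.card_image_of_injective, Finset.card_range]
  intro i j hij
  exact Nat.eq_of_mul_eq_mul_right hd (Nat.add_left_cancel hij)

theorem isAPSet_arithProg (a : ℕ) {d m : ℕ} (hd : 0 < d) (hm : 3 ≤ m) :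
    IsAPSet d (arithProg a d m) := by
  refine ⟨hd, by rwa [card_arithProg a m hd], a, ?_⟩
  rw [card_arithProg a m hd, arithProg]

theorem start_le_of_arithProg_subset {a b d e m n : ℕ} (hm : 0 < m)
    (h : arithProg a d m ⊆ arithProg b e n) : b ≤ a := by
  obtain ⟨i, -, hi⟩ := mem_arithProg.1 (h (mem_arithProg.2 ⟨0, hm, by simp⟩ : a ∈ _))
  omega

theorem start_eq_of_arithProg_eq {a b d e m n : ℕ} (hm : 0 < m) (hn : 0 < n)
    (h : arithProg a d m = arithProg b e n) : a = b :=
  le_antisymm (start_le_of_arithProg_subset hn h.ge) (start_le_of_arithProg_subset hm h.le)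

/-- If the ratio `k` of the differences is at most the length of the finer progression, the sumset
of two arithmetic progressions has no gaps. -/
theorem arithProg_add_arithProg (a b d : ℕ) {k m : ℕ} (n : ℕ) (hk : 0 < k) (hkm : k ≤ m) :
    arithProg a d m + arithProg b (k * d) (n + 1) = arithProg (a + b) d (m + k * n) := by
  ext x
  simp only [Finset.mem_add, mem_arithProg]
  constructor
  · rintro ⟨_, ⟨i, hi, rfl⟩, _, ⟨j, hj, rfl⟩, rfl⟩
    have := Nat.mul_le_mul_left k (Nat.le_of_lt_succ hj)
    exact ⟨i + k * j, by omega, by ring⟩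
  · rintro ⟨t, ht, rfl⟩
    by_cases htn : t < k * n
    · refine ⟨_, ⟨t % k, (Nat.mod_lt t hk).trans_le hkm, rfl⟩, _,
        ⟨t / k, (Nat.div_lt_of_lt_mul htn).trans n.lt_succ_self, rfl⟩, ?_⟩
      conv_rhs => rw [← Nat.mod_add_div t k]
      ring
    · obtain ⟨s, rfl⟩ := Nat.exists_eq_add_of_le (not_lt.1 htn)
      exact ⟨_, ⟨s, by omega, rfl⟩, _, ⟨n, n.lt_succ_self, rfl⟩, by ring⟩

/-- For every integer `k ≥ 2` and every `n ≥ 2`, the path graph on `n` vertices admits an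
identical biarithmetic IASI with multiplier `k`. -/
theorem stmt12 (k n : ℕ) (hk : 2 ≤ k) (hn : 2 ≤ n) :
    ∃ (f : Fin n → Finset ℕ) (dv : Fin n → ℕ),
      IsIdenticalBiarithmeticIASI (SimpleGraph.pathGraph n) f dv k := by
  let f : Fin n → Finset ℕ := fun v => arithProg v (k ^ v.val) (k + 1)
  have hpos (v : Fin n) : 0 < k ^ v.val := Nat.pow_pos (by omega)
  have hcard (v : Fin n) : (f v).card = k + 1 := card_arithProg _ _ (hpos v)
  have hsucc (u v : Fin n) (h : u.val + 1 = v.val) :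
      f u + f v = arithProg (u + v) (k ^ u.val) (k + 1 + k * k) := by
    have : k ^ v.val = k * k ^ u.val := by rw [← h, pow_succ']
    simp only [f, this]
    exact arithProg_add_arithProg _ _ _ k (by omega) (by omega)
  have hadj (u v : Fin n) (h : (SimpleGraph.pathGraph n).Adj u v) :
      ∃ d, 0 < d ∧ f u + f v = arithProg (u + v) d (k + 1 + k * k) := by
    rcases SimpleGraph.pathGraph_adj.1 h with h | h
    · exact ⟨_, hpos u, hsucc u v h⟩
    · exact ⟨_, hpos v, by rw [add_comm, hsucc v u h, add_comm v.val]⟩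
  refine ⟨f, fun v => k ^ v.val, ⟨?_, ?_, ?_⟩, by omega, ?_, ?_, ?_⟩
  · intro u v h
    exact Fin.ext (start_eq_of_arithProg_eq (by omega) (by omega) h)
  · intro v
    rw [← Finset.card_pos, hcard]
    omega
  · intro u v x y huv hxy h
    obtain ⟨d, -, hd⟩ := hadj u v huv
    obtain ⟨e, -, he⟩ := hadj x y hxy
    rw [hd, he] at h
    have hsum := start_eq_of_arithProg_eq (by omega) (by omega) h
    rw [SimpleGraph.pathGraph_adj] at huv hxy
    simp only [Sym2.eq_iff, Fin.ext_iff]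
    omega
  · exact fun v => isAPSet_arithProg _ (hpos v) (by omega)
  · intro u v h
    obtain ⟨d, hd, hsum⟩ := hadj u v h
    exact ⟨d, hsum ▸ isAPSet_arithProg _ hd (by omega)⟩
  · intro u v h
    simp only [hcard]
    rcases SimpleGraph.pathGraph_adj.1 h with h | h
    · exact Or.inl ⟨by rw [← h, pow_succ'], by omega⟩
    · exact Or.inr ⟨by rw [← h, pow_succ'], by omega⟩
end

section
/- Let G be a connected finite simple graph and let f be an identical biarithmetic IASI of G with multiplier k. Suppose the induced labeling of the line graph L(G) by e ↦ f⁺(e) is an identical biarithmetic labeling with the same multiplier k: every edge label f⁺(e) is an AP-set, and for any two distinct edges e₁, e₂ of G sharing an endpoint, the deterministic indices δ₁, δ₂ of f⁺(e₁), f⁺(e₂) satisfy δ₂ = k·δ₁ or δ₁ = k·δ₂. Then G is a path. -/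
open Pointwise

theorem IsAPSet.eq_of_forall_mem {δ d s : ℕ} {S : Finset ℕ} (hS : IsAPSet δ S)
    (hs : s ∈ S) (hsd : s + d ∈ S) (hmem : ∀ x ∈ S, ∃ i, x = s + i * d) : δ = d := by
  obtain ⟨-, hcard, a, ha⟩ := hS
  have hform : ∀ x ∈ S, ∃ j, x = a + j * δ := by
    intro x hx
    rw [ha] at hx
    obtain ⟨j, -, rfl⟩ := Finset.mem_image.1 hx
    exact ⟨j, rfl⟩
  have haS : a ∈ S := by
    rw [ha]
    exact Finset.mem_image.2 ⟨0, Finset.mem_range.2 (by omega), by simp⟩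
  have haδ : a + δ ∈ S := by
    rw [ha]
    exact Finset.mem_image.2 ⟨1, Finset.mem_range.2 (by omega), by simp⟩
  obtain ⟨i, hi⟩ := hmem a haS
  obtain ⟨j, hj⟩ := hform s hs
  obtain rfl : s = a := by omega
  obtain ⟨p, hp⟩ := hmem _ haδ
  obtain ⟨q, hq⟩ := hform _ hsd
  exact Nat.dvd_antisymm (Dvd.intro_left q (by omega)) (Dvd.intro_left p (by omega))

/-- If the index of `B` is a multiple of the index `d` of `A` and `A + B` is an AP-set, then
its index is `d`. -/
theorem IsAPSet.index_add {d k δ : ℕ} {A B : Finset ℕ} (hA : IsAPSet d A)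
    (hB : IsAPSet (k * d) B) (hAB : IsAPSet δ (A + B)) : δ = d := by
  obtain ⟨-, hcA, a, ha⟩ := hA
  obtain ⟨-, hcB, b, hb⟩ := hB
  have ha0 : a ∈ A := by
    rw [ha]
    exact Finset.mem_image.2 ⟨0, Finset.mem_range.2 (by omega), by simp⟩
  have ha1 : a + d ∈ A := by
    rw [ha]
    exact Finset.mem_image.2 ⟨1, Finset.mem_range.2 (by omega), by simp⟩
  have hb0 : b ∈ B := by
    rw [hb]
    exact Finset.mem_image.2 ⟨0, Finset.mem_range.2 (by omega), by simp⟩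
  refine hAB.eq_of_forall_mem (s := a + b) (Finset.add_mem_add ha0 hb0) ?_ ?_
  · rw [add_right_comm]
    exact Finset.add_mem_add ha1 hb0
  · intro x hx
    obtain ⟨y, hy, z, hz, rfl⟩ := Finset.mem_add.1 hx
    rw [ha] at hy
    rw [hb] at hz
    obtain ⟨i, -, rfl⟩ := Finset.mem_image.1 hy
    obtain ⟨j, -, rfl⟩ := Finset.mem_image.1 hz
    exact ⟨i + j * k, by ring⟩

/-- `w` is reached from `v` by exactly `n` steps of the relation `U`. -/
def ReachedIn {V : Type*} (U : V → V → Prop) (v : V) : ℕ → V → Prop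
  | 0, w => w = v
  | n + 1, w => ∃ x, ReachedIn U v n x ∧ U x w

/-- A finite connected graph is a path if its edges can be oriented, increasingly for some
function `φ` on the vertices, with all in- and out-degrees at most one. -/
theorem SimpleGraph.Connected.nonempty_iso_pathGraph {V : Type*} [Fintype V]
    {G : SimpleGraph V} (hconn : G.Connected) (U : V → V → Prop) (φ : V → ℕ)
    (hadj : ∀ u v, G.Adj u v ↔ U u v ∨ U v u) (hφ : ∀ u v, U u v → φ u < φ v)
    (hleft : ∀ a b c, U a b → U c b → a = c) (hright : ∀ a b c, U b a → U b c → a = c) :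
    Nonempty (G ≃g SimpleGraph.pathGraph (Fintype.card V)) := by
  classical
  have := hconn.nonempty
  obtain ⟨v₀, hmin⟩ := Finite.exists_min φ
  have hsource : ∀ x, ¬ U x v₀ := fun x hx => (hφ x v₀ hx).not_ge (hmin x)
  have hex : ∀ v, ∃ n, ReachedIn U v₀ n v := by
    intro v
    induction (SimpleGraph.reachable_iff_reflTransGen v₀ v).1 (hconn.preconnected v₀ v) with
    | refl => exact ⟨0, rfl⟩
    | @tail v w _ hvw ih =>
      obtain ⟨n, hn⟩ := ih
      rcases (hadj v w).1 hvw with h | h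
      · exact ⟨n + 1, v, hn, h⟩
      · cases n with
        | zero =>
          obtain rfl : v = v₀ := hn
          exact (hsource w h).elim
        | succ n =>
          obtain ⟨x, hx, hxv⟩ := hn
          exact ⟨n, hleft _ _ _ hxv h ▸ hx⟩
  have hvertex : ∀ n v w, ReachedIn U v₀ n v → ReachedIn U v₀ n w → v = w := by
    intro n
    induction n with
    | zero => exact fun v w hv hw => Eq.trans hv (Eq.symm hw)
    | succ n ih =>
      rintro v w ⟨x, hx, hxv⟩ ⟨y, hy, hyw⟩
      obtain rfl := ih x y hx hy
      exact hright _ _ _ hxv hyw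
  have hlength : ∀ n m v, ReachedIn U v₀ n v → ReachedIn U v₀ m v → n = m := by
    intro n
    induction n with
    | zero =>
      rintro (_ | m) v hv hm
      · rfl
      · obtain rfl : v = v₀ := hv
        obtain ⟨x, -, hx⟩ := hm
        exact (hsource x hx).elim
    | succ n ih =>
      rintro (_ | m) v ⟨x, hx, hxv⟩ hm
      · obtain rfl : v = v₀ := hm
        exact (hsource x hxv).elim
      · obtain ⟨y, hy, hyv⟩ := hm
        obtain rfl := hleft _ _ _ hxv hyv
        rw [ih m x hx hy]
  choose l hl using hex
  have hl_inj : Function.Injective l := fun v w hvw => hvertex _ v w (hl v) (hvw ▸ hl w)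
  have hU : ∀ u v, U u v ↔ l u + 1 = l v := by
    refine fun u v => ⟨fun h => hlength _ _ v ⟨u, hl u, h⟩ (hl v), fun h => ?_⟩
    obtain ⟨x, hx, hxv⟩ : ReachedIn U v₀ (l u + 1) v := h ▸ hl v
    rwa [hvertex _ u x (hl u) hx]
  have hinitial : ∀ n v, l v = n → ∀ m ≤ n, ∃ w, l w = m := by
    intro n
    induction n with
    | zero => exact fun v hv m hm => ⟨v, by omega⟩
    | succ n ih =>
      intro v hv m hm
      rcases hm.eq_or_lt with rfl | hm
      · exact ⟨v, hv⟩
      · obtain ⟨x, hx, -⟩ : ReachedIn U v₀ (n + 1) v := hv ▸ hl v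
        exact ih x (hlength _ _ x (hl x) hx) m (by omega)
  have hlt : ∀ v, l v < Fintype.card V := by
    intro v
    have hsub : Finset.range (l v + 1) ⊆ Finset.univ.image l := by
      intro m hm
      obtain ⟨w, hw⟩ := hinitial _ v rfl m (by simpa [Nat.lt_succ_iff] using hm)
      exact Finset.mem_image.2 ⟨w, Finset.mem_univ w, hw⟩
    have := (Finset.card_le_card hsub).trans Finset.card_image_le
    simpa [Nat.succ_le_iff] using this
  have hbij : Function.Bijective (fun v => (⟨l v, hlt v⟩ : Fin (Fintype.card V))) := by
    rw [Fintype.bijective_iff_injective_and_card]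
    exact ⟨fun v w h => hl_inj (Fin.mk.inj h), by simp⟩
  refine ⟨Equiv.ofBijective _ hbij, fun {u v} => ?_⟩
  rw [SimpleGraph.pathGraph_adj, hadj, hU, hU]
  rfl

/-- If `G` is connected, `f` is an identical biarithmetic IASI of `G` with multiplier `k`,
and the induced labeling of the line graph `L(G)` is identical biarithmetic with the same
multiplier `k`, then `G` is a path. -/
theorem stmt13 {V : Type*} [Fintype V] (G : SimpleGraph V) (hconn : G.Connected)
    (f : V → Finset ℕ) (dv : V → ℕ) (k : ℕ)
    (h : IsIdenticalBiarithmeticIASI G f dv k)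
    (hL : ∀ a b c δ₁ δ₂, G.Adj a b → G.Adj b c → s(a, b) ≠ s(b, c) →
      IsAPSet δ₁ (f a + f b) → IsAPSet δ₂ (f b + f c) →
      (δ₂ = k * δ₁ ∨ δ₁ = k * δ₂)) :
    ∃ n : ℕ, Nonempty (G ≃g SimpleGraph.pathGraph n) := by
  obtain ⟨-, hk, hAP, hedge, hmul⟩ := h
  have hne : ∀ v, dv v ≠ k * dv v := by
    intro v hv
    have := (hAP v).1
    nlinarith
  have hindex : ∀ u v δ, dv v = k * dv u → IsAPSet δ (f u + f v) → δ = dv u :=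
    fun u v δ huv hδ => (hAP u).index_add (huv ▸ hAP v) hδ
  have hdistinct : ∀ {a b c : V}, a ≠ c → s(a, b) ≠ s(b, c) := by
    intro a b c hac h
    rw [Sym2.eq_swap (a := b)] at h
    exact hac (Sym2.congr_left.1 h)
  refine ⟨_, hconn.nonempty_iso_pathGraph (fun u v => G.Adj u v ∧ dv v = k * dv u) dv
    ?_ ?_ ?_ ?_⟩
  · refine fun u v => ⟨fun h => ?_, ?_⟩
    · exact (hmul u v h).imp (fun h' => ⟨h, h'.1⟩) fun h' => ⟨h.symm, h'.1⟩
    · rintro (h | h)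
      exacts [h.1, h.1.symm]
  · rintro u v ⟨-, h⟩
    have := (hAP u).1
    nlinarith
  · rintro a b c ⟨hab, ha⟩ ⟨hcb, hc⟩
    by_contra hac
    obtain ⟨δ₁, h₁⟩ := hedge a b hab
    obtain ⟨δ₂, h₂⟩ := hedge b c hcb.symm
    have hδ := hL a b c δ₁ δ₂ hab hcb.symm (hdistinct hac) h₁ h₂
    have hda : dv a = dv c := Nat.eq_of_mul_eq_mul_left (by omega) (ha.symm.trans hc)
    rw [hindex a b δ₁ ha h₁, hindex c b δ₂ hc (add_comm (f b) (f c) ▸ h₂), hda] at hδ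
    exact hδ.elim (hne c) (hne c)
  · rintro a b c ⟨hba, ha⟩ ⟨hbc, hc⟩
    by_contra hac
    obtain ⟨δ₁, h₁⟩ := hedge a b hba.symm
    obtain ⟨δ₂, h₂⟩ := hedge b c hbc
    have hδ := hL a b c δ₁ δ₂ hba.symm hbc (hdistinct hac) h₁ h₂
    rw [hindex b a δ₁ ha (add_comm (f a) (f b) ▸ h₁), hindex b c δ₂ hc h₂] at hδ
    exact hδ.elim (hne b) (hne b)
end

section
/- Let f be an identical biarithmetic IASI with multiplier k of a finite simple graph G, let v be a vertex of G of degree 2 with non-adjacent neighbors u and w, and let H be the graph on V(G)∖{v} in which x, y are adjacent iff they are adjacent in G or {x,y} = {u,w} (an elementary topological reduction of G). Then the restriction of f to V(H) is not an identical biarithmetic labeling of H with multiplier k: the deterministic indices d_u, d_w of f(u), f(w) satisfy neither d_w = k·d_u nor d_u = k·d_w, although u and w are adjacent in H. -/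
open Pointwise

/-- Among three positive integers, it is impossible that in every pair one member is `k > 1`
times the other: for a number `c` related in this way to `a` and `b`, `b ≠ k * a`. -/
theorem ne_mul_of_common_ratio {k a b c : ℕ} (hk : 1 < k) (ha : 0 < a) (hb : 0 < b) (hc : 0 < c)
    (hac : a = k * c ∨ c = k * a) (hbc : b = k * c ∨ c = k * b) : b ≠ k * a := by
  have hlt : ∀ {x y : ℕ}, 0 < x → y = k * x → x < y := fun hx hy =>
    hy ▸ lt_mul_of_one_lt_left hx hk
  have hinj : ∀ {x y : ℕ}, k * x = k * y → x = y := fun h =>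
    Nat.eq_of_mul_eq_mul_left (by lia) h
  intro hab
  have hab_lt := hlt ha hab
  rcases hac with hac | hac <;> rcases hbc with hbc | hbc
  · exact (hlt hc hac).ne' (hinj (hab.symm.trans hbc))
  · have := hlt hc hac
    have := hlt hb hbc
    lia
  · exact (hlt ha hac).ne (hinj (hab.symm.trans hbc))
  · exact hab_lt.ne (hinj (hac.symm.trans hbc))

/-- Elementary topological reduction destroys identical biarithmeticity: if `f` is an
identical biarithmetic IASI of `G` with multiplier `k` and `v` is a degree-2 vertex with
non-adjacent neighbours `u` and `w` (which become adjacent in the reduced graph), then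
neither `d_w = k · d_u` nor `d_u = k · d_w`. -/
theorem stmt18 {V : Type*} [Fintype V] (G : SimpleGraph V)
    (f : V → Finset ℕ) (dv : V → ℕ) (k : ℕ)
    (h : IsIdenticalBiarithmeticIASI G f dv k)
    (v u w : V) (hn : G.neighborSet v = {u, w}) (huw : u ≠ w) (hnadj : ¬ G.Adj u w) :
    ¬ dv w = k * dv u ∧ ¬ dv u = k * dv w := by
  obtain ⟨-, hk, hAP, -, hratio⟩ := h
  have hpos : ∀ x, 0 < dv x := fun x => (hAP x).1
  have hneighbor : ∀ x ∈ G.neighborSet v, dv x = k * dv v ∨ dv v = k * dv x := fun x hx =>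
    (hratio v x hx).imp And.left And.left
  have hu := hneighbor u (by simp [hn])
  have hw := hneighbor w (by simp [hn])
  exact ⟨ne_mul_of_common_ratio hk (hpos u) (hpos w) (hpos v) hu hw,
    ne_mul_of_common_ratio hk (hpos w) (hpos u) (hpos v) hw hu⟩
end
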